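/- Let η > 0, let V^1, …, V^K ∈ ℝ^{N×M}, set L = 2η max_{k∈[K]} ‖V^k‖₁, let U ∈ ℝ^{N×M}, and let g ∈ ℝ^K be a vector with nonnegative entries. Then for all x, z in the standard simplex Δ_N, |xᵀ U 𝒴_QR(x) g − zᵀ U 𝒴_QR(z) g| ≤ (1 + L) ‖g‖₁ ‖U‖₁ ‖x − z‖_∞. -/

import Mathlib

/-- The quantal response map: `(qr η V x) i = exp(η⟨V_i, x⟩) / ∑_j exp(η⟨V_j, x⟩)`,
where `V_i` is the `i`-th column of `V ∈ ℝ^{N×M}`. -/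
noncomputable def qr {N M : ℕ} (η : ℝ) (V : Matrix (Fin N) (Fin M) ℝ)
    (x : Fin N → ℝ) (i : Fin M) : ℝ :=
  Real.exp (η * ∑ n, V n i * x n) / ∑ j, Real.exp (η * ∑ n, V n j * x n)

/-- The induced operator `1`-norm of a matrix `A`: `sup_{‖u‖₁ = 1} ‖A u‖₁`. -/
noncomputable def l1OpNorm {N M : ℕ} (A : Matrix (Fin N) (Fin M) ℝ) : ℝ :=
  sSup {r : ℝ | ∃ u : Fin M → ℝ, (∑ j, |u j|) = 1 ∧ r = ∑ i, |A.mulVec u i|}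

theorem l1OpNorm_nonneg {N M : ℕ} (A : Matrix (Fin N) (Fin M) ℝ) : 0 ≤ l1OpNorm A := by
  apply Real.sSup_nonneg
  rintro r ⟨u, -, rfl⟩
  positivity

theorem l1OpNorm_bdd {N M : ℕ} (A : Matrix (Fin N) (Fin M) ℝ) :
    BddAbove {r : ℝ | ∃ u : Fin M → ℝ, (∑ j, |u j|) = 1 ∧ r = ∑ i, |A.mulVec u i|} := by
  refine ⟨∑ i, ∑ j, |A i j|, ?_⟩
  rintro r ⟨u, hu, rfl⟩
  refine Finset.sum_le_sum fun i _ => ?_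
  have h0 : |A.mulVec u i| ≤ ∑ j, |A i j * u j| := by
    simp only [Matrix.mulVec, dotProduct]
    exact Finset.abs_sum_le_sum_abs _ _
  refine h0.trans (Finset.sum_le_sum fun j _ => ?_)
  rw [abs_mul]
  have : |u j| ≤ 1 := by
    rw [← hu]
    exact Finset.single_le_sum (f := fun j => |u j|) (fun _ _ => abs_nonneg _) (Finset.mem_univ j)
  exact mul_le_of_le_one_right (abs_nonneg _) this

theorem l1OpNorm_le {N M : ℕ} (A : Matrix (Fin N) (Fin M) ℝ) (u : Fin M → ℝ) :
    ∑ i, |A.mulVec u i| ≤ l1OpNorm A * ∑ j, |u j| := by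
  have h0 : 0 ≤ ∑ j, |u j| := by positivity
  rcases h0.eq_or_lt with h | h
  · have hu : u = 0 := by
      funext j
      have := (Finset.sum_eq_zero_iff_of_nonneg (fun j _ => abs_nonneg (u j))).1 h.symm j
        (Finset.mem_univ j)
      simpa using this
    subst hu
    simp
  · set S := ∑ j, |u j| with hS
    have key : ∑ i, |A.mulVec (S⁻¹ • u) i| ≤ l1OpNorm A := by
      refine le_csSup (l1OpNorm_bdd A) ⟨S⁻¹ • u, ?_, rfl⟩
      simp only [Pi.smul_apply, smul_eq_mul, abs_mul, ← Finset.mul_sum]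
      rw [abs_of_pos (inv_pos.2 h), ← hS, inv_mul_cancel₀ h.ne']
    rw [Matrix.mulVec_smul] at key
    simp only [Pi.smul_apply, smul_eq_mul, abs_mul, ← Finset.mul_sum] at key
    rw [abs_of_pos (inv_pos.2 h), inv_mul_le_iff₀ h] at key
    linarith

theorem col_le {N M : ℕ} (A : Matrix (Fin N) (Fin M) ℝ) (j : Fin M) :
    ∑ i, |A i j| ≤ l1OpNorm A := by
  have := l1OpNorm_le A (Pi.single j 1)
  have h2 : ∑ k, |(Pi.single j 1 : Fin M → ℝ) k| = 1 := by
    rw [Finset.sum_eq_single j] <;> simp +contextual [Pi.single_apply]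
  rw [h2] at this
  simpa using this

theorem wsum_le {M : ℕ} (s e : Fin M → ℝ) (d : ℝ) (he : ∀ j, 0 < e j) (hs : ∀ j, |s j| ≤ d) :
    |∑ j, s j * e j| ≤ d * ∑ j, e j := by
  rw [Finset.mul_sum]
  refine (Finset.abs_sum_le_sum_abs _ _).trans (Finset.sum_le_sum fun j _ => ?_)
  rw [abs_mul, abs_of_pos (he j)]
  exact mul_le_mul_of_nonneg_right (hs j) (he j).le

theorem softmax_lip {M : ℕ} (hM : 0 < M) (a b : Fin M → ℝ) (d : ℝ) (hd : ∀ j, |a j - b j| ≤ d) :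
    ∑ j, |Real.exp (a j) / (∑ k, Real.exp (a k)) - Real.exp (b j) / (∑ k, Real.exp (b k))|
      ≤ 2 * d := by
  haveI : Nonempty (Fin M) := ⟨⟨0, hM⟩⟩
  have hd0 : 0 ≤ d := (abs_nonneg _).trans (hd ⟨0, hM⟩)
  obtain ⟨s, hs, hsum⟩ : ∃ s : Fin M → ℝ, (∀ j, |s j| ≤ 1) ∧
      ∑ j, |Real.exp (a j) / (∑ k, Real.exp (a k)) - Real.exp (b j) / (∑ k, Real.exp (b k))|
      = ∑ j, s j * (Real.exp (a j) / (∑ k, Real.exp (a k))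
        - Real.exp (b j) / (∑ k, Real.exp (b k))) := by
    refine ⟨fun j => SignType.sign (Real.exp (a j) / (∑ k, Real.exp (a k))
        - Real.exp (b j) / (∑ k, Real.exp (b k))), fun j => ?_, ?_⟩
    · rcases SignType.trichotomy (SignType.sign (Real.exp (a j) / (∑ k, Real.exp (a k))
        - Real.exp (b j) / (∑ k, Real.exp (b k)))) with h | h | h <;> simp [h]
    · exact Finset.sum_congr rfl fun j _ => (sign_mul_self _).symm
  rw [hsum]
  let c : Fin M → ℝ := fun j => a j - b j
  let e : ℝ → Fin M → ℝ := fun t j => Real.exp (b j + t * c j)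
  have hepos : ∀ t j, 0 < e t j := fun t j => Real.exp_pos _
  have hE : ∀ t, 0 < ∑ j, e t j := fun t =>
    Finset.sum_pos (fun j _ => hepos t j) Finset.univ_nonempty
  have hde : ∀ t j, HasDerivAt (fun t => e t j) (c j * e t j) t := by
    intro t j
    have := (((hasDerivAt_id t).mul_const (c j)).const_add (b j)).exp
    have h2 : c j * e t j = Real.exp (b j + id t * c j) * (1 * c j) := by
      change c j * Real.exp (b j + t * c j) = Real.exp (b j + t * c j) * (1 * c j)
      ring
    rw [h2]
    exact this
  let φ : ℝ → ℝ := fun t => (∑ j, s j * e t j) / ∑ j, e t j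
  have hφ : ∀ t, HasDerivAt φ (((∑ j, s j * (c j * e t j)) * (∑ j, e t j) -
      (∑ j, s j * e t j) * (∑ j, c j * e t j)) / (∑ j, e t j) ^ 2) t := by
    intro t
    exact (HasDerivAt.fun_sum fun j _ => (hde t j).const_mul (s j)).div
      (HasDerivAt.fun_sum fun j _ => hde t j) (hE t).ne'
  have hb : ∀ t, ‖((∑ j, s j * (c j * e t j)) * (∑ j, e t j) -
      (∑ j, s j * e t j) * (∑ j, c j * e t j)) / (∑ j, e t j) ^ 2‖ ≤ 2 * d := by
    intro t
    have hEt := hE t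
    rw [Real.norm_eq_abs, abs_div, abs_of_pos (pow_pos hEt 2), div_le_iff₀ (pow_pos hEt 2)]
    have h1 : |∑ j, s j * (c j * e t j)| ≤ d * ∑ j, e t j := by
      simp only [← mul_assoc]
      refine wsum_le _ _ _ (hepos t) fun j => ?_
      rw [abs_mul]
      have := mul_le_mul (hs j) (hd j) (abs_nonneg _) zero_le_one
      simpa [c] using this
    have h2 : |∑ j, s j * e t j| ≤ 1 * ∑ j, e t j := wsum_le _ _ _ (hepos t) hs
    have h3 : |∑ j, c j * e t j| ≤ d * ∑ j, e t j := wsum_le _ _ _ (hepos t) hd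
    refine (abs_sub _ _).trans ?_
    rw [abs_mul, abs_mul, abs_of_pos hEt]
    have h4 := mul_le_mul_of_nonneg_right h1 hEt.le
    have h5 := mul_le_mul h2 h3 (abs_nonneg _) (by linarith)
    nlinarith
  have hmv := Convex.norm_image_sub_le_of_norm_hasDerivWithin_le (f := φ) (s := Set.univ)
    (x := 0) (y := 1) (fun t _ => (hφ t).hasDerivWithinAt) (fun t _ => hb t) convex_univ
    (Set.mem_univ _) (Set.mem_univ _)
  have heq : ∑ j, s j * (Real.exp (a j) / (∑ k, Real.exp (a k))
        - Real.exp (b j) / (∑ k, Real.exp (b k))) = φ 1 - φ 0 := by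
    simp only [φ, e, c, Finset.sum_div, mul_sub, Finset.sum_sub_distrib]
    simp [mul_div_assoc]
  rw [heq]
  refine (le_abs_self _).trans ?_
  simpa using hmv

theorem qr_lip {N M : ℕ} (hM : 0 < M) (η : ℝ) (hη : 0 < η) (V : Matrix (Fin N) (Fin M) ℝ)
    (x z : Fin N → ℝ) :
    ∑ j, |qr η V x j - qr η V z j| ≤ 2 * η * l1OpNorm V * ‖x - z‖ := by
  have := softmax_lip hM (fun j => η * ∑ n, V n j * x n) (fun j => η * ∑ n, V n j * z n)
    (η * (l1OpNorm V * ‖x - z‖)) (fun j => by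
      rw [← mul_sub, abs_mul, abs_of_pos hη, ← Finset.sum_sub_distrib]
      refine mul_le_mul_of_nonneg_left ?_ hη.le
      refine (Finset.abs_sum_le_sum_abs _ _).trans ?_
      refine le_trans ?_ (mul_le_mul_of_nonneg_right (col_le V j) (norm_nonneg _))
      rw [Finset.sum_mul]
      refine Finset.sum_le_sum fun n _ => ?_
      rw [← mul_sub, abs_mul]
      exact mul_le_mul_of_nonneg_left (norm_le_pi_norm (x - z) n) (abs_nonneg _))
  unfold qr
  linarith

theorem qr_sum {N M : ℕ} (hM : 0 < M) (η : ℝ) (V : Matrix (Fin N) (Fin M) ℝ)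
    (x : Fin N → ℝ) : ∑ j, |qr η V x j| = 1 := by
  haveI : Nonempty (Fin M) := ⟨⟨0, hM⟩⟩
  have hE : 0 < ∑ j, Real.exp (η * ∑ n, V n j * x n) :=
    Finset.sum_pos (fun j _ => Real.exp_pos _) Finset.univ_nonempty
  have : ∀ j, |qr η V x j| = qr η V x j := fun j =>
    abs_of_nonneg (div_nonneg (Real.exp_pos _).le hE.le)
  simp only [this]
  unfold qr
  rw [← Finset.sum_div, div_self hE.ne']

theorem bilin_le {N M : ℕ} (U : Matrix (Fin N) (Fin M) ℝ) (w : Fin N → ℝ) (u : Fin M → ℝ)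
    (c : ℝ) (hw : ∀ i, |w i| ≤ c) (hc : 0 ≤ c) :
    |∑ i, w i * ∑ j, U i j * u j| ≤ c * (l1OpNorm U * ∑ j, |u j|) := by
  refine le_trans ?_ (mul_le_mul_of_nonneg_left (l1OpNorm_le U u) hc)
  rw [Finset.mul_sum]
  refine (Finset.abs_sum_le_sum_abs _ _).trans (Finset.sum_le_sum fun i _ => ?_)
  rw [abs_mul]
  exact mul_le_mul_of_nonneg_right (hw i) (abs_nonneg _)

/-- **Lipschitz continuity of the leader utility (Corollary 1, first bound).**
For `η > 0`, matrices `V^1, …, V^K`, `L = 2η max_k ‖V^k‖₁`, a matrix `U ∈ ℝ^{N×M}` and a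
nonnegative vector `g ∈ ℝ^K`, for all `x, z ∈ Δ_N`:
`|xᵀ U 𝒴_QR(x) g − zᵀ U 𝒴_QR(z) g| ≤ (1+L) ‖g‖₁ ‖U‖₁ ‖x − z‖_∞`,
where `xᵀ U 𝒴_QR(x) g = ∑_k g_k ∑_i x_i ∑_j U_{ij} (y_{V^k}(x))_j` and `‖x - z‖` on
`Fin N → ℝ` is the sup norm. -/
theorem stmt5 {N M K : ℕ} (hK : 0 < K) (η : ℝ) (hη : 0 < η)
    (V : Fin K → Matrix (Fin N) (Fin M) ℝ) (L : ℝ)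
    (hL : L = 2 * η * Finset.univ.sup' (Finset.univ_nonempty_iff.mpr ⟨⟨0, hK⟩⟩)
      (fun k => l1OpNorm (V k)))
    (U : Matrix (Fin N) (Fin M) ℝ) (g : Fin K → ℝ) (hg : ∀ k, 0 ≤ g k) :
    ∀ x ∈ stdSimplex ℝ (Fin N), ∀ z ∈ stdSimplex ℝ (Fin N),
      |(∑ k, g k * ∑ i, x i * ∑ j, U i j * qr η (V k) x j) -
        ∑ k, g k * ∑ i, z i * ∑ j, U i j * qr η (V k) z j| ≤
      (1 + L) * (∑ k, |g k|) * l1OpNorm U * ‖x - z‖ := by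
  intro x hx z hz
  rcases Nat.eq_zero_or_pos M with hM | hM
  · subst hM
    have : l1OpNorm U = 0 := by simp [l1OpNorm]
    simp [this]
  rw [← Finset.sum_sub_distrib, Finset.mul_sum, Finset.sum_mul, Finset.sum_mul]
  refine (Finset.abs_sum_le_sum_abs _ _).trans (Finset.sum_le_sum fun k _ => ?_)
  have hLk : 2 * η * l1OpNorm (V k) ≤ L := by
    rw [hL]
    exact mul_le_mul_of_nonneg_left
      (Finset.le_sup' (fun k => l1OpNorm (V k)) (Finset.mem_univ k)) (by positivity)
  have hU := l1OpNorm_nonneg U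
  have hn := norm_nonneg (x - z)
  have h1 := bilin_le U (x - z) (qr η (V k) x) ‖x - z‖ (fun i => norm_le_pi_norm (x - z) i) hn
  rw [qr_sum hM] at h1
  have h2 := bilin_le U z (fun j => qr η (V k) x j - qr η (V k) z j) 1 (fun i => by
    rw [abs_of_nonneg (hz.1 i), ← hz.2]
    exact Finset.single_le_sum (fun i _ => hz.1 i) (Finset.mem_univ i)) zero_le_one
  have h3 : ∑ j, |qr η (V k) x j - qr η (V k) z j| ≤ L * ‖x - z‖ :=
    (qr_lip hM η hη (V k) x z).trans (mul_le_mul_of_nonneg_right hLk hn)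
  have h4 := mul_le_mul_of_nonneg_left h3 hU
  have heq : (∑ i, x i * ∑ j, U i j * qr η (V k) x j) - ∑ i, z i * ∑ j, U i j * qr η (V k) z j
      = (∑ i, (x - z) i * ∑ j, U i j * qr η (V k) x j)
        + ∑ i, z i * ∑ j, U i j * (qr η (V k) x j - qr η (V k) z j) := by
    simp only [Pi.sub_apply, sub_mul, mul_sub, Finset.sum_sub_distrib]
    ring
  rw [← mul_sub, abs_mul, heq]
  have h5 := (abs_add_le (∑ i, (x - z) i * ∑ j, U i j * qr η (V k) x j)
    (∑ i, z i * ∑ j, U i j * (qr η (V k) x j - qr η (V k) z j))).trans (add_le_add h1 h2)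
  calc _ ≤ |g k| * ((1 + L) * l1OpNorm U * ‖x - z‖) :=
        mul_le_mul_of_nonneg_left (by linarith) (abs_nonneg _)
    _ = _ := by ring
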